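/- Relative error bound for the conditioned tensorized data (Corollary 12.5). Let d ≥ 2, ℓ > 0, and let f_0 be a probability density on ℝ^d × ℝ^d with f_0(x,v) > 0 for all (x,v) and M := ‖f_0‖_{L^∞_x L^1_v} < ∞. In the Boltzmann–Grad scaling N ε^{d−1} = ℓ^{−1} (so ε = ε(N) → 0), for all sufficiently large N (in particular such that ℓ^{−1}|B_1^d| M ε < 1) the following holds simultaneously for all 1 ≤ s ≤ N: for (almost) every Z_s ∈ D_s, | f_N^{(s)}(0,Z_s) / ∏_{i=1}^s f_0(x_i,v_i) − 1 | ≤ ( 1 − ℓ^{−1} |B_1^d| M ε )^{−(s+1)} − 1, where |B_1^d| is the Lebesgue measure of the unit ball in ℝ^d. -/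

import Mathlib

noncomputable section
open MeasureTheory
open scoped BigOperators

/-- Euclidean space `ℝ^d`. -/
abbrev Rd (d : ℕ) := EuclideanSpace ℝ (Fin d)

/-- The `s`-particle hard-sphere phase space `D_s`: all pairwise distances exceed `ε`. -/
def Dset (d s : ℕ) (ε : ℝ) : Set (Fin s → Rd d × Rd d) :=
  {Z | ∀ i j : Fin s, i < j → ε < dist (Z i).1 (Z j).1}

/-- The partition function `𝒵_s = ∫ 1_{Z_s ∈ D_s} ∏ f₀(z_i) dZ_s`. -/
def partitionFunction (d s : ℕ) (ε : ℝ) (f₀ : Rd d × Rd d → ℝ) : ℝ :=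
  ∫ Z in Dset d s ε, ∏ i, f₀ (Z i)

/-- The volume of the unit ball in `ℝ^d`. -/
def unitBallVol (d : ℕ) : ℝ := (volume (Metric.ball (0 : Rd d) 1)).toReal

/-- The conditioned tensorized `N`-particle density
`f_N(0,Z_N) = 𝒵_N⁻¹ 1_{Z_N ∈ D_N} ∏ f₀(z_i)`. -/
def conditionedData (d N : ℕ) (ε : ℝ) (f₀ : Rd d × Rd d → ℝ)
    (Z : Fin N → Rd d × Rd d) : ℝ :=
  (partitionFunction d N ε f₀)⁻¹ *
    Set.indicator (Dset d N ε) (fun W => ∏ i, f₀ (W i)) Z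

/-- The `s`-particle marginal of an `N`-particle function. -/
def marginal (d N s : ℕ) (hsN : s ≤ N) (F : (Fin N → Rd d × Rd d) → ℝ)
    (Z : Fin s → Rd d × Rd d) : ℝ :=
  ∫ W : Fin (N - s) → Rd d × Rd d,
    F (Fin.append Z W ∘ Fin.cast (Nat.add_sub_cancel' hsN).symm)

section HardSpheres

open Set

variable {d : ℕ}

lemma measurableSet_Dset (s : ℕ) (ε : ℝ) : MeasurableSet (Dset d s ε) := by
  have : Dset d s ε = ⋂ i : Fin s, ⋂ j : Fin s, ⋂ _ : i < j,
      {Z | ε < dist (Z i).1 (Z j).1} := by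
    ext; simp [Dset]
  rw [this]
  refine .iInter fun i => .iInter fun j => .iInter fun _ => ?_
  exact measurableSet_lt measurable_const (by fun_prop)

lemma removeNth_mem_Dset {m : ℕ} {ε : ℝ} {W : Fin (m + 1) → Rd d × Rd d}
    (hW : W ∈ Dset d (m + 1) ε) (j : Fin (m + 1)) : j.removeNth W ∈ Dset d m ε :=
  fun _ _ hab => hW _ _ ((Fin.strictMono_succAbove j) hab)

lemma append_mem_Dset_iff {s m N : ℕ} (h : N = s + m) {ε : ℝ} (Z : Fin s → Rd d × Rd d)
    (W : Fin m → Rd d × Rd d) :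
    Fin.append Z W ∘ Fin.cast h ∈ Dset d N ε ↔
      Z ∈ Dset d s ε ∧ W ∈ Dset d m ε ∧ ∀ i j, ε < dist (Z i).1 (W j).1 := by
  subst h
  constructor
  · intro H
    refine ⟨fun i j hij => ?_, fun i j hij => ?_, fun i j => ?_⟩
    · simpa using H (Fin.castAdd m i) (Fin.castAdd m j) hij
    · simpa using H (Fin.natAdd s i) (Fin.natAdd s j) (by simpa using hij)
    · simpa using H (Fin.castAdd m i) (Fin.natAdd s j)
        (Fin.lt_def.2 (by simp only [Fin.val_castAdd, Fin.val_natAdd]; omega))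
  · rintro ⟨hZ, hW, hc⟩ a b hab
    induction a using Fin.addCases with
    | left i =>
      induction b using Fin.addCases with
      | left j => simpa using hZ i j hab
      | right j => simpa using hc i j
    | right i =>
      induction b using Fin.addCases with
      | left j =>
        rw [Fin.lt_def] at hab
        simp only [Fin.val_castAdd, Fin.val_natAdd] at hab
        omega
      | right j => simpa using hW i j (by simpa using hab)

lemma prod_append_cast {s m N : ℕ} (h : N = s + m) {α : Type*} (f : α → ℝ) (Z : Fin s → α)
    (W : Fin m → α) :
    ∏ i, f ((Fin.append Z W ∘ Fin.cast h) i) = (∏ i, f (Z i)) * ∏ i, f (W i) := by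
  subst h
  simp [Fin.prod_univ_add]

end HardSpheres

section Product

open Set

variable {α : Type*} [MeasurableSpace α]

/-- Freezing all coordinates but the `j`-th one in a product measure. -/
lemma pi_removeNth_le (μ : Measure α) [SigmaFinite μ] {m : ℕ} (j : Fin (m + 1))
    {A : Set (Fin m → α)} (hA : MeasurableSet A) {B : Set (α × (Fin m → α))}
    (hB : MeasurableSet B) {c : ENNReal} (hc : ∀ w, μ {z | (z, w) ∈ B} ≤ c) :
    Measure.pi (fun _ : Fin (m + 1) => μ) {W | j.removeNth W ∈ A ∧ (W j, j.removeNth W) ∈ B} ≤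
      c * Measure.pi (fun _ : Fin m => μ) A := by
  have hS : MeasurableSet ((univ ×ˢ A) ∩ B) := (MeasurableSet.univ.prod hA).inter hB
  have key := (measurePreserving_piFinSuccAbove (fun _ : Fin (m + 1) => μ) j).measure_preimage
    hS.nullMeasurableSet
  have heq : {W : Fin (m + 1) → α | j.removeNth W ∈ A ∧ (W j, j.removeNth W) ∈ B} =
      MeasurableEquiv.piFinSuccAbove (fun _ => α) j ⁻¹' ((univ ×ˢ A) ∩ B) := by
    ext W
    simp [MeasurableEquiv.piFinSuccAbove, Fin.insertNthEquiv]
  rw [heq, key, Measure.prod_apply_symm hS, ← lintegral_indicator_const hA]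
  refine lintegral_mono fun w => ?_
  by_cases hw : w ∈ A
  · simpa [hw, preimage] using hc w
  · simp [hw, preimage]

lemma pi_removeNth_eq (μ : Measure α) [IsProbabilityMeasure μ] {m : ℕ} (j : Fin (m + 1))
    {A : Set (Fin m → α)} (hA : MeasurableSet A) :
    Measure.pi (fun _ : Fin (m + 1) => μ) {W | j.removeNth W ∈ A} =
      Measure.pi (fun _ : Fin m => μ) A := by
  have hS : MeasurableSet ((univ : Set α) ×ˢ A) := MeasurableSet.univ.prod hA
  have key := (measurePreserving_piFinSuccAbove (fun _ : Fin (m + 1) => μ) j).measure_preimage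
    hS.nullMeasurableSet
  have heq : {W : Fin (m + 1) → α | j.removeNth W ∈ A} =
      MeasurableEquiv.piFinSuccAbove (fun _ => α) j ⁻¹' (univ ×ˢ A) := by
    ext W
    simp [MeasurableEquiv.piFinSuccAbove, Fin.insertNthEquiv]
  rw [heq, key, Measure.prod_prod, measure_univ, one_mul]

lemma pi_withDensity_ofReal (ν : Measure α) [SigmaFinite ν] {f : α → ℝ} (hf : Integrable f ν)
    (hf0 : ∀ z, 0 ≤ f z) (m : ℕ) :
    Measure.pi (fun _ : Fin m => ν.withDensity fun z => ENNReal.ofReal (f z)) =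
      (Measure.pi fun _ : Fin m => ν).withDensity
        fun Z => ENNReal.ofReal (∏ i, f (Z i)) := by
  have : IsFiniteMeasure (ν.withDensity fun z => ENNReal.ofReal (f z)) :=
    isFiniteMeasure_withDensity_ofReal hf.2
  refine Measure.pi_eq fun s hs => ?_
  rw [withDensity_apply _ (MeasurableSet.univ_pi hs), Measure.restrict_pi_pi,
    ← ofReal_integral_eq_lintegral_ofReal, integral_fintype_prod_eq_prod,
    ENNReal.ofReal_prod_of_nonneg]
  · refine Finset.prod_congr rfl fun i _ => ?_
    rw [withDensity_apply _ (hs i), ofReal_integral_eq_lintegral_ofReal hf.restrict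
      (ae_of_all _ hf0)]
  · exact fun i _ => integral_nonneg hf0
  · exact Integrable.fintype_prod fun i => hf.restrict
  · exact ae_of_all _ fun Z => Finset.prod_nonneg fun i _ => hf0 _

lemma setIntegral_prod_eq_pi_real (ν : Measure α) [SigmaFinite ν] {f : α → ℝ}
    (hf : Integrable f ν) (hf0 : ∀ z, 0 ≤ f z) {m : ℕ} {S : Set (Fin m → α)}
    (hS : MeasurableSet S) :
    ∫ Z in S, ∏ i, f (Z i) ∂(Measure.pi fun _ => ν) =
      (Measure.pi (fun _ : Fin m => ν.withDensity fun z => ENNReal.ofReal (f z))).real S := by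
  rw [pi_withDensity_ofReal ν hf hf0, measureReal_def, withDensity_apply _ hS,
    integral_eq_lintegral_of_nonneg_ae]
  · exact ae_of_all _ fun Z => Finset.prod_nonneg fun i _ => hf0 _
  · exact (Integrable.fintype_prod fun i => hf).aestronglyMeasurable.restrict

end Product

section Bounds

open Set

variable {d : ℕ} {ε κ : ℝ} (μ : Measure (Rd d × Rd d)) [IsProbabilityMeasure μ]

lemma pi_real_Dset_succ_le (m : ℕ) :
    (Measure.pi fun _ : Fin (m + 1) => μ).real (Dset d (m + 1) ε) ≤
      (Measure.pi fun _ : Fin m => μ).real (Dset d m ε) := by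
  have h := pi_removeNth_eq μ (0 : Fin (m + 1)) (measurableSet_Dset (d := d) m ε)
  rw [measureReal_def (μ := Measure.pi fun _ : Fin m => μ), ← h, ← measureReal_def]
  exact measureReal_mono fun W hW => removeNth_mem_Dset hW 0

lemma pi_real_Dset_antitone :
    Antitone fun m : ℕ => (Measure.pi fun _ : Fin m => μ).real (Dset d m ε) :=
  antitone_nat_of_succ_le (pi_real_Dset_succ_le μ)

/-- The mass of configurations of `m + 1` spheres in which the `j`-th one overlaps a sphere
depending on the others. -/
lemma pi_real_overlap_le (hκ : ∀ y, μ.real {z | dist z.1 y ≤ ε} ≤ κ) {m : ℕ} (j : Fin (m + 1))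
    {g : (Fin m → Rd d × Rd d) → Rd d} (hg : Measurable g) :
    (Measure.pi fun _ : Fin (m + 1) => μ).real
        {W | j.removeNth W ∈ Dset d m ε ∧ dist (W j).1 (g (j.removeNth W)) ≤ ε} ≤
      κ * (Measure.pi fun _ : Fin m => μ).real (Dset d m ε) := by
  have hκ0 : 0 ≤ κ := measureReal_nonneg.trans (hκ 0)
  have h := pi_removeNth_le μ j (measurableSet_Dset (d := d) m ε)
    (B := {p | dist p.1.1 (g p.2) ≤ ε}) (measurableSet_le (by fun_prop) measurable_const)
    (c := ENNReal.ofReal κ) fun w =>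
      (ENNReal.le_ofReal_iff_toReal_le (measure_ne_top _ _) hκ0).2 (hκ (g w))
  have h' := ENNReal.toReal_mono (by finiteness) h
  rwa [ENNReal.toReal_mul, ENNReal.toReal_ofReal hκ0] at h'

lemma le_pi_real_Dset_succ (hκ : ∀ y, μ.real {z | dist z.1 y ≤ ε} ≤ κ) (m : ℕ) :
    (1 - m * κ) * (Measure.pi fun _ : Fin m => μ).real (Dset d m ε) ≤
      (Measure.pi fun _ : Fin (m + 1) => μ).real (Dset d (m + 1) ε) := by
  set P := Measure.pi fun _ : Fin (m + 1) => μ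
  have h := pi_removeNth_eq μ (0 : Fin (m + 1)) (measurableSet_Dset (d := d) m ε)
  have hsub : {W : Fin (m + 1) → Rd d × Rd d | (0 : Fin (m + 1)).removeNth W ∈ Dset d m ε} ⊆
      Dset d (m + 1) ε ∪ ⋃ i : Fin m, {W | (0 : Fin (m + 1)).removeNth W ∈ Dset d m ε ∧
        dist (W 0).1 ((0 : Fin (m + 1)).removeNth W i).1 ≤ ε} := by
    intro W hW
    by_cases hi : ∃ i : Fin m, dist (W 0).1 ((0 : Fin (m + 1)).removeNth W i).1 ≤ ε
    · obtain ⟨i, hi⟩ := hi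
      exact Or.inr (mem_iUnion.2 ⟨i, hW, hi⟩)
    · push Not at hi
      left
      intro a b hab
      induction b using Fin.cases with
      | zero => exact absurd hab (Fin.not_lt_zero _)
      | succ b =>
        induction a using Fin.cases with
        | zero => simpa [Fin.removeNth_apply] using hi b
        | succ a => exact hW a b (by simpa using hab)
  have h1 : (Measure.pi fun _ : Fin m => μ).real (Dset d m ε) ≤
      P.real (Dset d (m + 1) ε) +
        ∑ _i : Fin m, κ * (Measure.pi fun _ : Fin m => μ).real (Dset d m ε) := by
    have h' : (Measure.pi fun _ : Fin m => μ).real (Dset d m ε) = P.real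
        {W : Fin (m + 1) → Rd d × Rd d | (0 : Fin (m + 1)).removeNth W ∈ Dset d m ε} :=
      congrArg ENNReal.toReal h.symm
    refine h'.le.trans <| (measureReal_mono hsub).trans ((measureReal_union_le _ _).trans ?_)
    gcongr
    refine (measureReal_iUnion_fintype_le _).trans (Finset.sum_le_sum fun i _ => ?_)
    exact pi_real_overlap_le μ hκ 0 (g := fun w => (w i).1) (by fun_prop)
  simp only [Finset.sum_const, Finset.card_univ, Fintype.card_fin, nsmul_eq_mul] at h1
  linarith

lemma pow_mul_le_pi_real_Dset_add (hκ : ∀ y, μ.real {z | dist z.1 y ≤ ε} ≤ κ) {N : ℕ}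
    (hN : N * κ ≤ 1) {m : ℕ} :
    ∀ s : ℕ, m + s ≤ N →
      (1 - N * κ) ^ s * (Measure.pi fun _ : Fin m => μ).real (Dset d m ε) ≤
        (Measure.pi fun _ : Fin (m + s) => μ).real (Dset d (m + s) ε) := by
  have hκ0 : 0 ≤ κ := measureReal_nonneg.trans (hκ 0)
  intro s
  induction s with
  | zero => intro _; simp
  | succ s ih =>
    intro hs
    have hcast : ((m + s : ℕ) : ℝ) ≤ N := by exact_mod_cast (by omega : m + s ≤ N)
    refine le_trans ?_ (le_pi_real_Dset_succ μ hκ (m + s))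
    rw [pow_succ', mul_assoc]
    have := ih (by omega)
    have h0 : 0 ≤ 1 - N * κ := by linarith
    have h1 : 1 - N * κ ≤ 1 - (m + s : ℕ) * κ := by gcongr
    exact mul_le_mul h1 this (by positivity) (h0.trans h1)

/-- Adding `s` frozen spheres to `m + 1` random ones costs at most `s (m + 1) κ 𝒵_m`. -/
lemma le_pi_real_Dset_inter (hκ : ∀ y, μ.real {z | dist z.1 y ≤ ε} ≤ κ) {s m : ℕ}
    (Z : Fin s → Rd d × Rd d) :
    (Measure.pi fun _ : Fin (m + 1) => μ).real (Dset d (m + 1) ε) -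
        s * ((m + 1 : ℕ) * (κ * (Measure.pi fun _ : Fin m => μ).real (Dset d m ε))) ≤
      (Measure.pi fun _ : Fin (m + 1) => μ).real
        {W | W ∈ Dset d (m + 1) ε ∧ ∀ i j, ε < dist (Z i).1 (W j).1} := by
  have hsub : Dset d (m + 1) ε ⊆
      {W | W ∈ Dset d (m + 1) ε ∧ ∀ i j, ε < dist (Z i).1 (W j).1} ∪
        ⋃ i : Fin s, ⋃ j : Fin (m + 1), {W | j.removeNth W ∈ Dset d m ε ∧
          dist (W j).1 (Z i).1 ≤ ε} := by
    intro W hW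
    by_cases hc : ∀ i j, ε < dist (Z i).1 (W j).1
    · exact Or.inl ⟨hW, hc⟩
    · push Not at hc
      obtain ⟨i, j, hij⟩ := hc
      rw [dist_comm] at hij
      exact Or.inr (mem_iUnion.2 ⟨i, mem_iUnion.2 ⟨j, removeNth_mem_Dset hW j, hij⟩⟩)
  have h1 := (measureReal_mono (μ := Measure.pi fun _ : Fin (m + 1) => μ) hsub).trans
    (measureReal_union_le _ _)
  have h2 : (Measure.pi fun _ : Fin (m + 1) => μ).real
      (⋃ i : Fin s, ⋃ j : Fin (m + 1), {W | j.removeNth W ∈ Dset d m ε ∧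
          dist (W j).1 (Z i).1 ≤ ε}) ≤
      ∑ _i : Fin s, ∑ _j : Fin (m + 1),
        κ * (Measure.pi fun _ : Fin m => μ).real (Dset d m ε) := by
    refine (measureReal_iUnion_fintype_le _).trans (Finset.sum_le_sum fun i _ => ?_)
    refine (measureReal_iUnion_fintype_le _).trans (Finset.sum_le_sum fun j _ => ?_)
    exact pi_real_overlap_le μ hκ j (g := fun _ => (Z i).1) measurable_const
  simp only [Finset.sum_const, Finset.card_univ, Fintype.card_fin, nsmul_eq_mul] at h2
  linarith

/-- The relative error of the conditioned marginal, in terms of the one-particle bound `κ`. -/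
lemma abs_pi_real_div_sub_one_le (hκ : ∀ y, μ.real {z | dist z.1 y ≤ ε} ≤ κ) {N s m : ℕ}
    (hsm : N = m + s) (hN : N * κ < 1) (Z : Fin s → Rd d × Rd d) :
    |(Measure.pi fun _ : Fin m => μ).real
          {W | W ∈ Dset d m ε ∧ ∀ i j, ε < dist (Z i).1 (W j).1} /
        (Measure.pi fun _ : Fin N => μ).real (Dset d N ε) - 1| ≤
      ((1 - N * κ) ^ (s + 1))⁻¹ - 1 := by
  have hκ0 : 0 ≤ κ := measureReal_nonneg.trans (hκ 0)
  set δ : ℝ := N * κ with hδ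
  have hδ0 : 0 ≤ δ := by positivity
  have hq : 0 < 1 - δ := by linarith
  have hq1 : 1 - δ ≤ 1 := by linarith
  set z : ℕ → ℝ := fun k => (Measure.pi fun _ : Fin k => μ).real (Dset d k ε) with hz
  have hz0 : z 0 = 1 := by
    have : Dset d 0 ε = univ := by ext; simp [Dset]
    simp [hz, this]
  have hpow : ∀ k r, k + r ≤ N → (1 - δ) ^ r * z k ≤ z (k + r) := fun k r hkr =>
    pow_mul_le_pi_real_Dset_add μ hκ hN.le r hkr
  have hzpos : ∀ k ≤ N, 0 < z k := fun k hk => by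
    have h := hpow 0 k (by omega)
    rw [hz0, mul_one, zero_add] at h
    exact (pow_pos hq k).trans_le h
  have hzN := hzpos N le_rfl
  have hanti : Antitone z := pi_real_Dset_antitone μ
  set A := (Measure.pi fun _ : Fin m => μ).real
    {W | W ∈ Dset d m ε ∧ ∀ i j, ε < dist (Z i).1 (W j).1} with hA
  have hAle : A ≤ z m := measureReal_mono fun W hW => hW.1
  have hup : A / z N ≤ ((1 - δ) ^ (s + 1))⁻¹ := by
    have h1 : (1 - δ) ^ s * z m ≤ z N := by
      rw [hsm]
      exact hpow m s hsm.ge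
    have h2 : A / z N ≤ ((1 - δ) ^ s)⁻¹ := by
      rw [div_le_iff₀ hzN, ← div_eq_inv_mul, le_div_iff₀ (pow_pos hq s)]
      nlinarith [mul_le_mul_of_nonneg_left hAle (pow_pos hq s).le]
    refine h2.trans (inv_anti₀ (pow_pos hq _) ?_)
    exact pow_le_pow_of_le_one hq.le hq1 (Nat.le_succ s)
  have hlow : 1 - s * (δ / (1 - δ)) ≤ A / z N := by
    rw [le_div_iff₀ hzN]
    rcases m with _ | m
    · have hA1 : A = 1 := by
        have : {W : Fin 0 → Rd d × Rd d | W ∈ Dset d 0 ε ∧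
            ∀ i j, ε < dist (Z i).1 (W j).1} = univ := by ext; simp [Dset]
        rw [hA, this]
        simp
      have hzN1 : z N ≤ 1 := hz0 ▸ hanti (Nat.zero_le N)
      have : 0 ≤ s * (δ / (1 - δ)) := by positivity
      rw [hA1]
      nlinarith
    · have h1 : z (m + 1) - s * ((m + 1 : ℕ) * (κ * z m)) ≤ A := le_pi_real_Dset_inter μ hκ Z
      have h2 : (1 - δ) * z m ≤ z (m + 1) := by simpa using hpow m 1 (by omega)
      have h3 : z N ≤ z (m + 1) := hanti (by omega)
      have hzm : z m ≤ z (m + 1) / (1 - δ) := by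
        rw [le_div_iff₀ hq]
        linarith
      have h4 : ((m + 1 : ℕ) : ℝ) * (κ * z m) ≤ δ / (1 - δ) * z (m + 1) := by
        have hmN : ((m + 1 : ℕ) : ℝ) ≤ N := by exact_mod_cast (by omega : m + 1 ≤ N)
        have hzm0 : 0 ≤ z m := (hzpos m (by omega)).le
        calc ((m + 1 : ℕ) : ℝ) * (κ * z m) ≤ N * (κ * (z (m + 1) / (1 - δ))) := by gcongr
          _ = δ / (1 - δ) * z (m + 1) := by rw [hδ]; ring
      have h5 : (1 - s * (δ / (1 - δ))) * z (m + 1) ≤ A := by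
        have := mul_le_mul_of_nonneg_left h4 (Nat.cast_nonneg (α := ℝ) s)
        nlinarith
      rcases le_total 0 (1 - s * (δ / (1 - δ))) with h0 | h0
      · exact (mul_le_mul_of_nonneg_left h3 h0).trans h5
      · exact (mul_nonpos_of_nonpos_of_nonneg h0 hzN.le).trans measureReal_nonneg
  have hbern : 1 + s * (δ / (1 - δ)) ≤ ((1 - δ) ^ (s + 1))⁻¹ := by
    have ht : 0 ≤ δ / (1 - δ) := by positivity
    have h1 : (1 - δ)⁻¹ = 1 + δ / (1 - δ) := by field_simp; ring
    have h2 := one_add_mul_le_pow (a := δ / (1 - δ)) (by linarith) (s + 1)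
    rw [← inv_pow, h1]
    push_cast at h2
    linarith
  rw [abs_le]
  constructor <;> linarith

end Bounds

section Density

open Set

variable {d : ℕ} {f₀ : Rd d × Rd d → ℝ} {M : ℝ}

lemma lintegral_velocity_le (hint : Integrable f₀) (h0 : ∀ z, 0 ≤ f₀ z)
    (hM : ∀ᵐ x : Rd d, (∫ v : Rd d, f₀ (x, v)) ≤ M) :
    ∀ᵐ x : Rd d, ∫⁻ v : Rd d, ENNReal.ofReal (f₀ (x, v)) ≤ ENNReal.ofReal M := by
  rw [Measure.volume_eq_prod] at hint
  filter_upwards [hM, hint.prod_right_ae] with x hx hix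
  rw [← ofReal_integral_eq_lintegral_ofReal hix (ae_of_all _ fun v => h0 _)]
  exact ENNReal.ofReal_le_ofReal hx

lemma withDensity_cylinder_le (hmeas : Measurable f₀) (hint : Integrable f₀)
    (h0 : ∀ z, 0 ≤ f₀ z) (hM0 : 0 ≤ M) (hM : ∀ᵐ x : Rd d, (∫ v : Rd d, f₀ (x, v)) ≤ M)
    {ε : ℝ} (hε : 0 ≤ ε) (y : Rd d) :
    ((volume : Measure (Rd d × Rd d)).withDensity fun z => ENNReal.ofReal (f₀ z)).real
      {z | dist z.1 y ≤ ε} ≤ M * (ε ^ d * unitBallVol d) := by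
  have hset : {z : Rd d × Rd d | dist z.1 y ≤ ε} = Metric.closedBall y ε ×ˢ univ := by
    ext; simp
  have hle : ((volume : Measure (Rd d × Rd d)).withDensity fun z => ENNReal.ofReal (f₀ z))
      {z | dist z.1 y ≤ ε} ≤ ENNReal.ofReal M * volume (Metric.closedBall y ε) := by
    rw [hset, withDensity_apply _ (Metric.isClosed_closedBall.measurableSet.prod .univ),
      Measure.volume_eq_prod, ← Measure.prod_restrict, Measure.restrict_univ,
      lintegral_prod _ (by fun_prop), ← setLIntegral_const]
    exact lintegral_mono_ae (ae_restrict_of_ae (lintegral_velocity_le hint h0 hM))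
  have hvol : (volume (Metric.closedBall y ε)).toReal = ε ^ d * unitBallVol d := by
    simpa [measureReal_def, unitBallVol] using
      Measure.addHaar_real_closedBall (volume : Measure (Rd d)) y hε
  have hfin : volume (Metric.closedBall y ε) ≠ ⊤ := measure_closedBall_lt_top.ne
  have h := ENNReal.toReal_mono (by finiteness) hle
  rwa [ENNReal.toReal_mul, ENNReal.toReal_ofReal hM0, hvol] at h

lemma marginal_conditionedData (hint : Integrable f₀) (h0 : ∀ z, 0 ≤ f₀ z) {N s : ℕ}
    (hsN : s ≤ N) {ε : ℝ} {Z : Fin s → Rd d × Rd d} (hZ : Z ∈ Dset d s ε) :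
    marginal d N s hsN (conditionedData d N ε f₀) Z =
      (∏ i, f₀ (Z i)) *
        ((Measure.pi fun _ : Fin (N - s) => (volume : Measure (Rd d × Rd d)).withDensity
            fun z => ENNReal.ofReal (f₀ z)).real
            {W | W ∈ Dset d (N - s) ε ∧ ∀ i j, ε < dist (Z i).1 (W j).1} /
          (Measure.pi fun _ : Fin N => (volume : Measure (Rd d × Rd d)).withDensity
            fun z => ENNReal.ofReal (f₀ z)).real (Dset d N ε)) := by
  set E : Set (Fin (N - s) → Rd d × Rd d) :=
    {W | W ∈ Dset d (N - s) ε ∧ ∀ i j, ε < dist (Z i).1 (W j).1} with hE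
  have hEmeas : MeasurableSet E := by
    have hEeq : E = Dset d (N - s) ε ∩ ⋂ i, ⋂ j, {W | ε < dist (Z i).1 (W j).1} := by
      ext; simp [hE]
    rw [hEeq]
    refine (measurableSet_Dset (N - s) ε).inter ?_
    exact .iInter fun i => .iInter fun j => measurableSet_lt measurable_const (by fun_prop)
  have hpt : ∀ W : Fin (N - s) → Rd d × Rd d,
      conditionedData d N ε f₀
        (Fin.append Z W ∘ Fin.cast (Nat.add_sub_cancel' hsN).symm) =
      ((partitionFunction d N ε f₀)⁻¹ * ∏ i, f₀ (Z i)) *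
        E.indicator (fun W => ∏ i, f₀ (W i)) W := by
    intro W
    have hiff := append_mem_Dset_iff (Nat.add_sub_cancel' hsN).symm (ε := ε) Z W
    rw [conditionedData, mul_assoc]
    by_cases hW : W ∈ E
    · rw [indicator_of_mem (hiff.2 ⟨hZ, hW⟩), indicator_of_mem hW, prod_append_cast]
    · rw [indicator_of_notMem fun h => hW (hiff.1 h).2, indicator_of_notMem hW, mul_zero, mul_zero,
        mul_zero]
  rw [marginal, integral_congr_ae (ae_of_all _ hpt), integral_const_mul,
    integral_indicator hEmeas, partitionFunction, volume_pi, volume_pi,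
    setIntegral_prod_eq_pi_real _ hint h0 hEmeas,
    setIntegral_prod_eq_pi_real _ hint h0 (measurableSet_Dset N ε)]
  ring

end Density

lemma exists_forall_mul_lt_one_of_mul_pow_eq {C a : ℝ} {k : ℕ} (hC : 0 ≤ C) :
    ∃ N₀ : ℕ, ∀ N : ℕ, N₀ ≤ N → ∀ ε : ℝ, 0 < ε → (N : ℝ) * ε ^ k = a → C * ε < 1 := by
  rcases hC.eq_or_lt with rfl | hC
  · exact ⟨0, by simp⟩
  obtain ⟨N₀, hN₀⟩ := exists_nat_gt (a * C ^ k)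
  refine ⟨N₀, fun N hN ε hε h => ?_⟩
  by_contra! hge
  have h1 : 1 ≤ (C * ε) ^ k := one_le_pow₀ hge
  have h2 : (N : ℝ) ≤ a * C ^ k := by
    calc (N : ℝ) ≤ N * (C * ε) ^ k := le_mul_of_one_le_right (Nat.cast_nonneg N) h1
      _ = a * C ^ k := by rw [← h]; ring
  have h3 : (N₀ : ℝ) ≤ N := by exact_mod_cast hN
  linarith

/-- **Relative error bound for the conditioned tensorized data (Corollary 12.5).**
For a strictly positive probability density `f₀` with `‖f₀‖_{L^∞_x L^1_v} ≤ M`, in the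
Boltzmann–Grad scaling `N ε^{d−1} = ℓ⁻¹`, for all sufficiently large `N` (in particular
such that `ℓ⁻¹ |B_1^d| M ε < 1`) one has, simultaneously for all `1 ≤ s ≤ N` and almost
every `Z_s ∈ D_s`:
`|f_N^{(s)}(0,Z_s)/∏ f₀(z_i) − 1| ≤ (1 − ℓ⁻¹ |B_1^d| M ε)^{−(s+1)} − 1`. -/
theorem conditioned_data_relative_error_bound
    (d : ℕ) (hd : 2 ≤ d) (ℓ M : ℝ) (hℓ : 0 < ℓ)
    (f₀ : Rd d × Rd d → ℝ) (hmeas : Measurable f₀) (hpos : ∀ z, 0 < f₀ z)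
    (hint : Integrable f₀) (hmass : ∫ z, f₀ z = 1)
    (hM : ∀ᵐ x : Rd d, (∫ v : Rd d, f₀ (x, v)) ≤ M) :
    ∃ N₀ : ℕ, ∀ N : ℕ, N₀ ≤ N → ∀ ε : ℝ, 0 < ε → (N : ℝ) * ε ^ (d - 1) = ℓ⁻¹ →
      ℓ⁻¹ * unitBallVol d * M * ε < 1 ∧
      ∀ s : ℕ, 1 ≤ s → ∀ hsN : s ≤ N,
        ∀ᵐ Z ∂(volume.restrict (Dset d s ε)),
          |marginal d N s hsN (conditionedData d N ε f₀) Z / (∏ i, f₀ (Z i)) - 1|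
            ≤ ((1 - ℓ⁻¹ * unitBallVol d * M * ε) ^ (s + 1))⁻¹ - 1 := by
  have h0 : ∀ z, 0 ≤ f₀ z := fun z => (hpos z).le
  have hM0 : 0 ≤ M := by
    obtain ⟨x, hx⟩ := hM.exists
    exact (integral_nonneg fun v => h0 (x, v)).trans hx
  obtain ⟨N₀, hN₀⟩ := exists_forall_mul_lt_one_of_mul_pow_eq
    (C := ℓ⁻¹ * unitBallVol d * M) (a := ℓ⁻¹) (k := d - 1)
    (mul_nonneg (mul_nonneg (inv_nonneg.2 hℓ.le) ENNReal.toReal_nonneg) hM0)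
  refine ⟨N₀, fun N hN ε hε hscale => ⟨hN₀ N hN ε hε hscale, fun s _ hsN => ?_⟩⟩
  have hprob : IsProbabilityMeasure ((volume : Measure (Rd d × Rd d)).withDensity
      fun z => ENNReal.ofReal (f₀ z)) := by
    constructor
    rw [withDensity_apply _ .univ, Measure.restrict_univ,
      ← ofReal_integral_eq_lintegral_ofReal hint (ae_of_all _ h0), hmass, ENNReal.ofReal_one]
  have hδ : ℓ⁻¹ * unitBallVol d * M * ε = N * (M * (ε ^ d * unitBallVol d)) := by
    obtain ⟨k, rfl⟩ : ∃ k, d = k + 1 := ⟨d - 1, by omega⟩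
    rw [← hscale, Nat.add_sub_cancel]
    ring
  have hlt := hN₀ N hN ε hε hscale
  rw [hδ] at hlt ⊢
  refine (ae_restrict_iff' (measurableSet_Dset s ε)).2 (ae_of_all _ fun Z hZ => ?_)
  rw [marginal_conditionedData hint h0 hsN hZ,
    mul_div_cancel_left₀ _ (Finset.prod_pos fun i _ => hpos (Z i)).ne']
  exact abs_pi_real_div_sub_one_le _
    (withDensity_cylinder_le hmeas hint h0 hM0 hM hε.le) (by omega) hlt Z
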